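/- Consider the StackMST(0,0) game whose red tree is a path P on n ≥ 4 vertices with consecutive edges e_1, …, e_{n−1} and costs c(e_1) = 1, c(e_2) = 2, and c(e_i) = 0 for every i > 2. Then the optimal revenue is exactly r*(P, c) = 2, while the total red cost is c(P) = 3. -/

import Mathlib

namespace StackMST

variable {V : Type*}

/-- Sum of an edge-weight function over a set of edges. -/
noncomputable def esum (w : Sym2 V → ℝ) (s : Set (Sym2 V)) : ℝ := ∑ᶠ e ∈ s, w e

/-- `M` is a spanning tree of `G`. -/
def IsSpanningTreeOf (G M : SimpleGraph V) : Prop := M ≤ G ∧ M.IsTree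

/-- Total weight of `M`, where red edges (the edges of `T`) are weighted by `c`
and all other (blue) edges are weighted by `p`. -/
noncomputable def weight (T : SimpleGraph V) (c p : Sym2 V → ℝ) (M : SimpleGraph V) : ℝ :=
  esum c (M.edgeSet ∩ T.edgeSet) + esum p (M.edgeSet \ T.edgeSet)

/-- Total price of the blue edges of `M`. -/
noncomputable def blueRevenue (T : SimpleGraph V) (p : Sym2 V → ℝ) (M : SimpleGraph V) : ℝ :=
  esum p (M.edgeSet \ T.edgeSet)

/-- The leader's revenue once `F` and `p` are fixed: the follower selects a
minimum-weight spanning tree of `T ⊔ F` and, among those, one maximizing the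
total price of the blue edges it contains. -/
noncomputable def followerRevenue (T : SimpleGraph V) (c : Sym2 V → ℝ)
    (F : SimpleGraph V) (p : Sym2 V → ℝ) : ℝ :=
  sSup {r | ∃ M : SimpleGraph V, IsSpanningTreeOf (T ⊔ F) M ∧
    (∀ M' : SimpleGraph V, IsSpanningTreeOf (T ⊔ F) M' →
        weight T c p M ≤ weight T c p M') ∧
    r = blueRevenue T p M}

/-- `F` is a set of blue edges: none of its edges is a red edge. -/
def IsBlueSet (T F : SimpleGraph V) : Prop := F ≤ Tᶜ

/-- `r(F)`: the best revenue the leader can obtain from the activated set `F`. -/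
noncomputable def revenueOf (T : SimpleGraph V) (c : Sym2 V → ℝ) (F : SimpleGraph V) : ℝ :=
  sSup {r | ∃ p : Sym2 V → ℝ, (∀ e ∈ F.edgeSet, 0 ≤ p e) ∧ r = followerRevenue T c F p}

/-- Optimal revenue `r*(T, c)` of the StackMST(0,0) game on the red tree `T`. -/
noncomputable def optRevenue (T : SimpleGraph V) (c : Sym2 V → ℝ) : ℝ :=
  sSup {r | ∃ (F : SimpleGraph V) (p : Sym2 V → ℝ), IsBlueSet T F ∧
    (∀ e ∈ F.edgeSet, 0 ≤ p e) ∧ r = followerRevenue T c F p}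

/-- Total cost `c(T)` of the red edges. -/
noncomputable def redCost (T : SimpleGraph V) (c : Sym2 V → ℝ) : ℝ := esum c T.edgeSet

/-- Optimal revenue of the budgeted game StackMST(γ, Δ). -/
noncomputable def gammaOptRevenue (T : SimpleGraph V) (c γ : Sym2 V → ℝ) (Δ : ℝ) : ℝ :=
  sSup {r | ∃ F : SimpleGraph V, IsBlueSet T F ∧ esum γ F.edgeSet ≤ Δ ∧
    r = revenueOf T c F}

end StackMST

namespace StackMST

/-- The `i`-th red edge of the path graph on `Fin (m+1)`,
joining vertex `i` to vertex `i+1`. -/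
def pathEdge (m : ℕ) (i : Fin m) : Sym2 (Fin (m+1)) := s(Fin.castSucc i, Fin.succ i)

/-- The consecutive edges `l, …, r` of the path form an `a`-block:
all of them have cost `a` and the run is maximal. -/
def IsABlock (m : ℕ) (c : Sym2 (Fin (m+1)) → ℝ) (a : ℝ) (l r : Fin m) : Prop :=
  l ≤ r ∧
  (∀ i : Fin m, l ≤ i → i ≤ r → c (pathEdge m i) = a) ∧
  (∀ i : Fin m, (i : ℕ) + 1 = (l : ℕ) → c (pathEdge m i) ≠ a) ∧
  (∀ i : Fin m, (r : ℕ) + 1 = (i : ℕ) → c (pathEdge m i) ≠ a)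

/-- A bad `a`-block: an `a`-block with at most 2 edges. -/
def IsBadBlock (m : ℕ) (c : Sym2 (Fin (m+1)) → ℝ) (a : ℝ) (l r : Fin m) : Prop :=
  IsABlock m c a l r ∧ (r : ℕ) ≤ (l : ℕ) + 1

/-- `σ`: the number of bad `a`-blocks of the path. -/
noncomputable def badBlockCount (m : ℕ) (c : Sym2 (Fin (m+1)) → ℝ) (a : ℝ) : ℕ :=
  Set.ncard {q : Fin m × Fin m | IsBadBlock m c a q.1 q.2}

/-- `min { σ·a , ⌊σ/2⌋·(b − a) + (σ − 2·⌊σ/2⌋)·min{a, b − a} }`. -/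
noncomputable def twoCostBound (a b : ℝ) (σ : ℕ) : ℝ :=
  min ((σ : ℝ) * a)
    (((σ / 2 : ℕ) : ℝ) * (b - a) + ((σ : ℝ) - 2 * ((σ / 2 : ℕ) : ℝ)) * min a (b - a))

end StackMST


namespace StackMST

open Classical in
/-- combined edge weight -/
noncomputable def cw {V : Type*} (T : SimpleGraph V) (c p : Sym2 V → ℝ) (e : Sym2 V) : ℝ :=
  if e ∈ T.edgeSet then c e else p e

open Classical in
/-- the edges as a finset -/
noncomputable def ef {V : Type*} [Fintype V] (M : SimpleGraph V) : Finset (Sym2 V) :=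
  Finset.univ.filter (fun e => e ∈ M.edgeSet)

theorem mem_ef {V : Type*} [Fintype V] (M : SimpleGraph V) (e : Sym2 V) :
    e ∈ ef M ↔ e ∈ M.edgeSet := by simp [ef]

open Classical in
theorem esum_eq {V : Type*} [Fintype V] (w : Sym2 V → ℝ) (s : Set (Sym2 V)) :
    esum w s = ∑ e ∈ Finset.univ.filter (fun e => e ∈ s), w e := by
  unfold esum
  rw [finsum_mem_eq_toFinset_sum]
  congr 1
  ext e; simp

open Classical in
theorem weight_eq {V : Type*} [Fintype V] (T : SimpleGraph V) (c p : Sym2 V → ℝ)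
    (M : SimpleGraph V) : weight T c p M = ∑ e ∈ ef M, cw T c p e := by
  unfold weight
  rw [esum_eq, esum_eq, ← Finset.sum_filter_add_sum_filter_not (ef M) (fun e => e ∈ T.edgeSet)]
  congr 1
  · refine Finset.sum_congr ?_ ?_
    · ext e; simp [mem_ef]
    · intro e he; simp at he; simp [cw, he]
  · refine Finset.sum_congr ?_ ?_
    · ext e; simp [mem_ef]
    · intro e he; simp at he; simp [cw, he]

theorem weight_ge {V : Type*} [Fintype V] (T : SimpleGraph V) (c p : Sym2 V → ℝ)
    (M : SimpleGraph V) (h0 : ∀ e ∈ M.edgeSet, 0 ≤ cw T c p e) (S : Finset (Sym2 V))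
    (hS : ∀ e ∈ S, e ∈ M.edgeSet) : ∑ e ∈ S, cw T c p e ≤ weight T c p M := by
  rw [weight_eq]
  refine Finset.sum_le_sum_of_subset_of_nonneg ?_ ?_
  · intro e he; rw [mem_ef]; exact hS e he
  · intro e he _; exact h0 e ((mem_ef _ _).1 he)

theorem weight_le {V : Type*} [Fintype V] (T : SimpleGraph V) (c p : Sym2 V → ℝ)
    (M : SimpleGraph V) (S : Finset (Sym2 V)) (h0 : ∀ e ∈ S, 0 ≤ cw T c p e)
    (hS : ∀ e ∈ M.edgeSet, e ∈ S ∨ cw T c p e = 0) : weight T c p M ≤ ∑ e ∈ S, cw T c p e := by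
  classical
  rw [weight_eq]
  have : ∑ e ∈ ef M, cw T c p e = ∑ e ∈ (ef M).filter (fun e => e ∈ S), cw T c p e := by
    symm
    refine Finset.sum_subset (Finset.filter_subset _ _) ?_
    intro e he hne
    rcases hS e ((mem_ef _ _).1 he) with h | h
    · exact absurd (Finset.mem_filter.2 ⟨he, h⟩) hne
    · exact h
  rw [this]
  refine Finset.sum_le_sum_of_subset_of_nonneg ?_ ?_
  · intro e he; exact (Finset.mem_filter.1 he).2
  · intro e he _; exact h0 e he

open Classical in
theorem blue_eq {V : Type*} [Fintype V] (T : SimpleGraph V) (c p : Sym2 V → ℝ)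
    (M : SimpleGraph V) :
    blueRevenue T p M = ∑ e ∈ (ef M).filter (fun e => e ∉ T.edgeSet), cw T c p e := by
  unfold blueRevenue
  rw [esum_eq]
  refine Finset.sum_congr ?_ ?_
  · ext e; simp [mem_ef]
  · intro e he; simp at he; simp [cw, he]

/-- A minimum spanning tree is no heavier than any connected subgraph. -/
theorem min_conn {V : Type*} [Fintype V] (T : SimpleGraph V) (c p : Sym2 V → ℝ)
    (G M H : SimpleGraph V) (h0 : ∀ e ∈ G.edgeSet, 0 ≤ cw T c p e)
    (hmin : ∀ M' : SimpleGraph V, IsSpanningTreeOf G M' → weight T c p M ≤ weight T c p M')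
    (hH : H ≤ G) (hc : H.Connected) : weight T c p M ≤ weight T c p H := by
  obtain ⟨M', hle, ht⟩ := hc.exists_isTree_le
  refine (hmin M' ⟨hle.trans hH, ht⟩).trans ?_
  rw [weight_eq T c p M']
  refine weight_ge T c p H (fun e he => h0 e (SimpleGraph.edgeSet_mono hH he)) _ ?_
  intro e he
  exact SimpleGraph.edgeSet_mono hle ((mem_ef _ _).1 he)

section path
variable {m : ℕ}

theorem c_val (c : Sym2 (Fin (m + 1)) → ℝ)
    (hc : ∀ i : Fin m, c (pathEdge m i) =
      if (i : ℕ) = 0 then 1 else if (i : ℕ) = 1 then 2 else 0)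
    (a b : Fin (m + 1)) (h : (a : ℕ) + 1 = b) :
    c s(a, b) = if (a : ℕ) = 0 then 1 else if (a : ℕ) = 1 then 2 else 0 := by
  have hlt : (a : ℕ) < m := by have := b.2; omega
  have := hc ⟨a, hlt⟩
  have e : pathEdge m ⟨a, hlt⟩ = s(a, b) := by
    unfold pathEdge
    have e1 : Fin.castSucc ⟨(a : ℕ), hlt⟩ = a := Fin.ext (by simp)
    have e2 : Fin.succ ⟨(a : ℕ), hlt⟩ = b := Fin.ext (by simp [h])
    rw [e1, e2]
  rw [e] at this
  exact this

theorem tail_reach (H : SimpleGraph (Fin (m + 1))) 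
    (h : ∀ a b : Fin (m + 1), 2 ≤ (a : ℕ) → (a : ℕ) + 1 = b → H.Adj a b)
    (a b : Fin (m + 1)) (ha : 2 ≤ (a : ℕ)) (hb : 2 ≤ (b : ℕ)) : H.Reachable a b := by
  have key : ∀ k : ℕ, ∀ a b : Fin (m + 1), 2 ≤ (a : ℕ) → (a : ℕ) + k = b → H.Reachable a b := by
    intro k
    induction k with
    | zero =>
      intro a b _ hab
      have : a = b := by ext; omega
      subst this; exact SimpleGraph.Reachable.refl _
    | succ k ih =>
      intro a b ha hab
      have hb := b.2
      let d : Fin (m + 1) := ⟨a + k, by omega⟩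
      exact (ih a d ha rfl).trans (h d b (by simp [d]; omega) (by simp [d]; omega)).reachable
  rcases le_total (a : ℕ) b with hab | hab
  · exact key (b - a) a b ha (by omega)
  · exact (key (a - b) b a hb (by omega)).symm

theorem conn_of (H : SimpleGraph (Fin (m + 1)))
    (h : ∀ a b : Fin (m + 1), 2 ≤ (a : ℕ) → (a : ℕ) + 1 = b → H.Adj a b)
    (h01 : ∀ a b : Fin (m + 1), (a : ℕ) = 0 → (b : ℕ) = 1 → H.Adj a b)
    (x y : Fin (m + 1)) (hx : (x : ℕ) < 2) (hy : 2 ≤ (y : ℕ)) (hxy : H.Adj x y) :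
    H.Connected := by
  have hm := y.2
  have r01 : ∀ a b : Fin (m + 1), (a : ℕ) < 2 → (b : ℕ) < 2 → H.Reachable a b := by
    intro a b ha hb
    rcases lt_trichotomy (a : ℕ) b with hl | hl | hl
    · exact (h01 a b (by omega) (by omega)).reachable
    · have : a = b := Fin.ext hl
      subst this; exact SimpleGraph.Reachable.refl _
    · exact (h01 b a (by omega) (by omega)).reachable.symm
  have ry : ∀ a : Fin (m + 1), H.Reachable a y := by
    intro a
    by_cases ha : (a : ℕ) < 2
    · exact (r01 a x ha hx).trans hxy.reachable
    · exact tail_reach H h a y (by omega) hy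
  have : Nonempty (Fin (m + 1)) := ⟨x⟩
  exact SimpleGraph.Connected.mk (fun a b => (ry a).trans (ry b).symm)

theorem exists_cross (M : SimpleGraph (Fin (m + 1))) (hM : M.Connected)
    (P : Fin (m + 1) → Prop) (u v : Fin (m + 1)) (hu : P u) (hv : ¬ P v) :
    ∃ a b, P a ∧ ¬ P b ∧ M.Adj a b := by
  obtain ⟨w⟩ := hM.preconnected u v
  obtain ⟨d, _, h1, h2⟩ := w.exists_boundary_dart {x | P x} hu hv
  exact ⟨d.fst, d.snd, h1, h2, d.adj⟩

/-- nonnegativity of the combined weight -/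
theorem cw_nonneg (c p : Sym2 (Fin (m + 1)) → ℝ)
    (hc : ∀ i : Fin m, c (pathEdge m i) =
      if (i : ℕ) = 0 then 1 else if (i : ℕ) = 1 then 2 else 0)
    (F : SimpleGraph (Fin (m + 1))) (hp : ∀ e ∈ F.edgeSet, 0 ≤ p e) :
    ∀ e ∈ (SimpleGraph.pathGraph (m + 1) ⊔ F).edgeSet,
      0 ≤ cw (SimpleGraph.pathGraph (m + 1)) c p e := by
  intro e he
  unfold cw
  split_ifs with h
  · induction e using Sym2.ind with
    | _ a b =>
      rw [SimpleGraph.mem_edgeSet, SimpleGraph.pathGraph_adj] at h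
      rcases h with h | h
      · rw [c_val c hc a b h]; split_ifs <;> norm_num
      · rw [Sym2.eq_swap, c_val c hc b a h]; split_ifs <;> norm_num
  · rw [SimpleGraph.edgeSet_sup] at he
    exact hp e (he.resolve_left h)

theorem cw_red (c p : Sym2 (Fin (m + 1)) → ℝ)
    (hc : ∀ i : Fin m, c (pathEdge m i) =
      if (i : ℕ) = 0 then 1 else if (i : ℕ) = 1 then 2 else 0)
    (a b : Fin (m + 1)) (h : (a : ℕ) + 1 = b) :
    cw (SimpleGraph.pathGraph (m + 1)) c p s(a, b) =
      if (a : ℕ) = 0 then 1 else if (a : ℕ) = 1 then 2 else 0 := by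
  unfold cw
  rw [if_pos, c_val c hc a b h]
  rw [SimpleGraph.mem_edgeSet, SimpleGraph.pathGraph_adj]
  exact Or.inl h

/-- classification of red edges -/
theorem red_cases (c p : Sym2 (Fin (m + 1)) → ℝ)
    (hc : ∀ i : Fin m, c (pathEdge m i) =
      if (i : ℕ) = 0 then 1 else if (i : ℕ) = 1 then 2 else 0)
    (v0 v1 v2 : Fin (m + 1)) (h0 : (v0 : ℕ) = 0) (h1 : (v1 : ℕ) = 1) (h2 : (v2 : ℕ) = 2)
    (e : Sym2 (Fin (m + 1))) (he : e ∈ (SimpleGraph.pathGraph (m + 1)).edgeSet) :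
    e = s(v0, v1) ∨ e = s(v1, v2) ∨ cw (SimpleGraph.pathGraph (m + 1)) c p e = 0 := by
  have key : ∀ a b : Fin (m + 1), (a : ℕ) + 1 = b → s(a, b) = s(v0, v1) ∨ s(a, b) = s(v1, v2) ∨
      cw (SimpleGraph.pathGraph (m + 1)) c p s(a, b) = 0 := by
    intro a b h
    rw [cw_red c p hc a b h]
    by_cases ha : (a : ℕ) = 0
    · left
      have e1 : a = v0 := Fin.ext (by omega)
      have e2 : b = v1 := Fin.ext (by omega)
      rw [e1, e2]
    · by_cases ha' : (a : ℕ) = 1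
      · right; left
        have e1 : a = v1 := Fin.ext (by omega)
        have e2 : b = v2 := Fin.ext (by omega)
        rw [e1, e2]
      · right; right
        simp [ha, ha']
  induction e using Sym2.ind with
  | _ a b =>
    rw [SimpleGraph.mem_edgeSet, SimpleGraph.pathGraph_adj] at he
    rcases he with h | h
    · exact key a b h
    · rw [Sym2.eq_swap]; exact key b a h

theorem e01_ne_e12 (v0 v1 v2 : Fin (m + 1)) (h0 : (v0 : ℕ) = 0) (h1 : (v1 : ℕ) = 1)
    (h2 : (v2 : ℕ) = 2) : s(v0, v1) ≠ s(v1, v2) := by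
  intro h
  rw [Sym2.eq_iff] at h
  rcases h with ⟨h, _⟩ | ⟨h, _⟩ <;> · have := congrArg Fin.val h; omega

/-- weight of the comparison graph `path - 12 + f` -/
theorem comparison (c p : Sym2 (Fin (m + 1)) → ℝ)
    (hc : ∀ i : Fin m, c (pathEdge m i) =
      if (i : ℕ) = 0 then 1 else if (i : ℕ) = 1 then 2 else 0)
    (v0 v1 v2 : Fin (m + 1)) (h0 : (v0 : ℕ) = 0) (h1 : (v1 : ℕ) = 1) (h2 : (v2 : ℕ) = 2)
    (F : SimpleGraph (Fin (m + 1))) (hp : ∀ e ∈ F.edgeSet, 0 ≤ p e)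
    (a b : Fin (m + 1)) (ha : (a : ℕ) < 2) (hb : 2 ≤ (b : ℕ)) (hab : F.Adj a b)
    (hblue : ¬ (SimpleGraph.pathGraph (m + 1)).Adj a b) :
    ∃ H : SimpleGraph (Fin (m + 1)), H ≤ SimpleGraph.pathGraph (m + 1) ⊔ F ∧ H.Connected ∧
      (∀ e ∈ H.edgeSet, e ∉ (SimpleGraph.pathGraph (m + 1)).edgeSet → e = s(a, b)) ∧
      ¬ H.Adj v1 v2 ∧
      weight (SimpleGraph.pathGraph (m + 1)) c p H ≤
        1 + cw (SimpleGraph.pathGraph (m + 1)) c p s(a, b) := by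
  have hne : s(a, b) ≠ s(v1, v2) := by
    intro h
    apply hblue
    rw [← SimpleGraph.mem_edgeSet, h, SimpleGraph.mem_edgeSet, SimpleGraph.pathGraph_adj]
    left; omega
  have hne' : s(v0, v1) ≠ s(a, b) := by
    intro h
    apply hblue
    rw [← SimpleGraph.mem_edgeSet, ← h, SimpleGraph.mem_edgeSet, SimpleGraph.pathGraph_adj]
    left; omega
  have habne : a ≠ b := by rintro rfl; omega
  let H : SimpleGraph (Fin (m + 1)) :=
    (SimpleGraph.pathGraph (m + 1)).deleteEdges {s(v1, v2)} ⊔ SimpleGraph.fromEdgeSet {s(a, b)}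
  have hmem : ∀ e, e ∈ H.edgeSet ↔
      (e ∈ (SimpleGraph.pathGraph (m + 1)).edgeSet ∧ e ≠ s(v1, v2)) ∨ e = s(a, b) := by
    intro e
    simp only [H, SimpleGraph.edgeSet_sup, SimpleGraph.edgeSet_deleteEdges,
      SimpleGraph.edgeSet_fromEdgeSet]
    constructor
    · rintro (h | h)
      · exact Or.inl ⟨h.1, h.2⟩
      · exact Or.inr h.1
    · rintro (h | h)
      · exact Or.inl ⟨h.1, h.2⟩
      · refine Or.inr ⟨h, ?_⟩
        subst h
        simpa using habne
  have hle : H ≤ SimpleGraph.pathGraph (m + 1) ⊔ F := by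
    rw [← SimpleGraph.edgeSet_subset_edgeSet]
    intro e he
    rw [SimpleGraph.edgeSet_sup]
    rcases (hmem e).1 he with h | h
    · exact Or.inl h.1
    · right; rw [h]; exact hab
  refine ⟨H, hle, ?_, ?_, ?_, ?_⟩
  · refine conn_of H ?_ ?_ a b ha hb ?_
    · intro x y hx hxy
      rw [← SimpleGraph.mem_edgeSet, hmem]
      left
      refine ⟨?_, ?_⟩
      · rw [SimpleGraph.mem_edgeSet, SimpleGraph.pathGraph_adj]; exact Or.inl hxy
      · intro h
        rw [Sym2.eq_iff] at h
        rcases h with ⟨h, h'⟩ | ⟨h, h'⟩ <;>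
        · have := congrArg Fin.val h; have := congrArg Fin.val h'; omega
    · intro x y hx hy
      rw [← SimpleGraph.mem_edgeSet, hmem]
      left
      refine ⟨?_, ?_⟩
      · rw [SimpleGraph.mem_edgeSet, SimpleGraph.pathGraph_adj]; left; omega
      · exact e01_ne_e12 x y v2 hx hy h2 |> fun h => by
          have : y = v1 := Fin.ext (by omega)
          rwa [this] at h ⊢
    · rw [← SimpleGraph.mem_edgeSet, hmem]; exact Or.inr rfl
  · intro e he hr
    rcases (hmem e).1 he with h | h
    · exact absurd h.1 hr
    · exact h
  · rw [← SimpleGraph.mem_edgeSet, hmem]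
    rintro (h | h)
    · exact h.2 rfl
    · exact hne h.symm
  · have h01 : cw (SimpleGraph.pathGraph (m + 1)) c p s(v0, v1) = 1 := by
      rw [cw_red c p hc v0 v1 (by omega), if_pos h0]
    have := weight_le (SimpleGraph.pathGraph (m + 1)) c p H {s(v0, v1), s(a, b)} ?_ ?_
    · rwa [Finset.sum_pair hne', h01] at this
    · intro e he
      simp only [Finset.mem_insert, Finset.mem_singleton] at he
      rcases he with rfl | rfl
      · rw [h01]; norm_num
      · exact cw_nonneg c p hc F hp _ (by rw [SimpleGraph.edgeSet_sup]; exact Or.inr hab)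
    · intro e he
      simp only [Finset.mem_insert, Finset.mem_singleton]
      rcases (hmem e).1 he with h | h
      · rcases red_cases c p hc v0 v1 v2 h0 h1 h2 e h.1 with h' | h' | h'
        · exact Or.inl (Or.inl h')
        · exact absurd h' h.2
        · exact Or.inr h'
      · exact Or.inl (Or.inr h)

theorem path_weight_le (c p : Sym2 (Fin (m + 1)) → ℝ)
    (hc : ∀ i : Fin m, c (pathEdge m i) =
      if (i : ℕ) = 0 then 1 else if (i : ℕ) = 1 then 2 else 0)
    (v0 v1 v2 : Fin (m + 1)) (h0 : (v0 : ℕ) = 0) (h1 : (v1 : ℕ) = 1) (h2 : (v2 : ℕ) = 2) :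
    weight (SimpleGraph.pathGraph (m + 1)) c p (SimpleGraph.pathGraph (m + 1)) = 3 := by
  have h01 : cw (SimpleGraph.pathGraph (m + 1)) c p s(v0, v1) = 1 := by
    rw [cw_red c p hc v0 v1 (by omega), if_pos h0]
  have h12 : cw (SimpleGraph.pathGraph (m + 1)) c p s(v1, v2) = 2 := by
    rw [cw_red c p hc v1 v2 (by omega), if_neg (by omega), if_pos h1]
  have hs : ∑ e ∈ {s(v0, v1), s(v1, v2)}, cw (SimpleGraph.pathGraph (m + 1)) c p e = 3 := by
    rw [Finset.sum_pair (e01_ne_e12 v0 v1 v2 h0 h1 h2), h01, h12]; norm_num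
  apply le_antisymm
  · rw [← hs]
    refine weight_le _ c p _ _ ?_ ?_
    · intro e he
      simp only [Finset.mem_insert, Finset.mem_singleton] at he
      rcases he with rfl | rfl
      · rw [h01]; norm_num
      · rw [h12]; norm_num
    · intro e he
      simp only [Finset.mem_insert, Finset.mem_singleton]
      rcases red_cases c p hc v0 v1 v2 h0 h1 h2 e he with h' | h' | h'
      · exact Or.inl (Or.inl h')
      · exact Or.inl (Or.inr h')
      · exact Or.inr h'
  · rw [← hs]
    refine weight_ge _ c p _ ?_ _ ?_
    · intro e he
      refine cw_nonneg c p hc ⊥ ?_ e ?_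
      · intro e he; simp at he
      · simpa using he
    · intro e he
      simp only [Finset.mem_insert, Finset.mem_singleton] at he
      rcases he with rfl | rfl <;>
      · rw [SimpleGraph.mem_edgeSet, SimpleGraph.pathGraph_adj]; left; omega

/-- Every minimum spanning tree has blue revenue at most `2`. -/
theorem blue_le_two (c p : Sym2 (Fin (m + 1)) → ℝ)
    (hc : ∀ i : Fin m, c (pathEdge m i) =
      if (i : ℕ) = 0 then 1 else if (i : ℕ) = 1 then 2 else 0)
    (v0 v1 v2 : Fin (m + 1)) (h0 : (v0 : ℕ) = 0) (h1 : (v1 : ℕ) = 1) (h2 : (v2 : ℕ) = 2)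
    (F : SimpleGraph (Fin (m + 1))) (hp : ∀ e ∈ F.edgeSet, 0 ≤ p e)
    (M : SimpleGraph (Fin (m + 1)))
    (hM : IsSpanningTreeOf (SimpleGraph.pathGraph (m + 1) ⊔ F) M)
    (hmin : ∀ M', IsSpanningTreeOf (SimpleGraph.pathGraph (m + 1) ⊔ F) M' →
      weight (SimpleGraph.pathGraph (m + 1)) c p M ≤
        weight (SimpleGraph.pathGraph (m + 1)) c p M') :
    blueRevenue (SimpleGraph.pathGraph (m + 1)) p M ≤ 2 := by
  classical
  have hnn := cw_nonneg c p hc F hp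
  have hnnM : ∀ e ∈ M.edgeSet, 0 ≤ cw (SimpleGraph.pathGraph (m + 1)) c p e :=
    fun e he => hnn e (SimpleGraph.edgeSet_mono hM.1 he)
  have hcomp := fun H => min_conn _ c p _ M H hnn hmin
  have hW3 := hcomp _ le_sup_left (SimpleGraph.pathGraph_connected m)
  rw [path_weight_le c p hc v0 v1 v2 h0 h1 h2] at hW3
  have hMF : ∀ a b, M.Adj a b → ¬ (SimpleGraph.pathGraph (m + 1)).Adj a b → F.Adj a b := by
    intro a b h hn
    exact (hM.1 h).resolve_left hn
  -- edges inside the tail are free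
  let inC : Sym2 (Fin (m + 1)) → Prop := fun e => ∀ v ∈ e, 2 ≤ (v : ℕ)
  have hfree : ∀ e ∈ M.edgeSet, inC e → cw (SimpleGraph.pathGraph (m + 1)) c p e = 0 := by
    let H : SimpleGraph (Fin (m + 1)) := SimpleGraph.fromEdgeSet
      ({e | e ∈ M.edgeSet ∧ ¬ inC e} ∪
        {e | e ∈ (SimpleGraph.pathGraph (m + 1)).edgeSet ∧ inC e})
    have hmem : ∀ e, e ∈ H.edgeSet ↔ (e ∈ M.edgeSet ∧ ¬ inC e) ∨
        (e ∈ (SimpleGraph.pathGraph (m + 1)).edgeSet ∧ inC e) := by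
      intro e
      simp only [H, SimpleGraph.edgeSet_fromEdgeSet]
      constructor
      · intro h; exact h.1
      · intro h
        refine ⟨h, ?_⟩
        rcases h with h | h
        · exact SimpleGraph.not_isDiag_of_mem_edgeSet _ h.1
        · exact SimpleGraph.not_isDiag_of_mem_edgeSet _ h.1
    have hle : H ≤ SimpleGraph.pathGraph (m + 1) ⊔ F := by
      rw [← SimpleGraph.edgeSet_subset_edgeSet]
      intro e he
      rcases (hmem e).1 he with h | h
      · exact SimpleGraph.edgeSet_mono hM.1 h.1
      · rw [SimpleGraph.edgeSet_sup]; exact Or.inl h.1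
    have htail : ∀ a b : Fin (m + 1), 2 ≤ (a : ℕ) → (a : ℕ) + 1 = b → H.Adj a b := by
      intro a b ha hab
      rw [← SimpleGraph.mem_edgeSet, hmem]
      right
      refine ⟨?_, ?_⟩
      · rw [SimpleGraph.mem_edgeSet, SimpleGraph.pathGraph_adj]; exact Or.inl hab
      · intro v hv
        rw [Sym2.mem_iff] at hv
        rcases hv with rfl | rfl <;> omega
    have hadj : ∀ a b, M.Adj a b → H.Reachable a b := by
      intro a b hab
      by_cases hC : inC s(a, b)
      · exact tail_reach H htail a b (hC a (by simp)) (hC b (by simp))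
      · refine SimpleGraph.Adj.reachable ?_
        rw [← SimpleGraph.mem_edgeSet, hmem]
        exact Or.inl ⟨hab, hC⟩
    have hconn : H.Connected := by
      have : Nonempty (Fin (m + 1)) := ⟨v0⟩
      refine SimpleGraph.Connected.mk (fun a b => ?_)
      obtain ⟨w⟩ := hM.2.connected.preconnected a b
      induction w with
      | nil => exact SimpleGraph.Reachable.refl _
      | cons h _ ih => exact (hadj _ _ h).trans ih
    have hW := hcomp _ hle hconn
    have hS : weight (SimpleGraph.pathGraph (m + 1)) c p H ≤
        ∑ e ∈ (ef M).filter (fun e => ¬ inC e), cw (SimpleGraph.pathGraph (m + 1)) c p e := by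
      refine weight_le _ c p _ _ ?_ ?_
      · intro e he
        exact hnnM e ((mem_ef _ _).1 (Finset.mem_filter.1 he).1)
      · intro e he
        rcases (hmem e).1 he with h | h
        · exact Or.inl (Finset.mem_filter.2 ⟨(mem_ef _ _).2 h.1, h.2⟩)
        · right
          rcases red_cases c p hc v0 v1 v2 h0 h1 h2 e h.1 with h' | h' | h'
          · have := h.2 v0 (by rw [h']; simp); omega
          · have := h.2 v1 (by rw [h']; simp); omega
          · exact h'
    intro e he hC
    have hge := weight_ge (SimpleGraph.pathGraph (m + 1)) c p M hnnM
      (insert e ((ef M).filter (fun e => ¬ inC e))) (by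
        intro x hx
        rcases Finset.mem_insert.1 hx with rfl | hx
        · exact he
        · exact (mem_ef _ _).1 (Finset.mem_filter.1 hx).1)
    rw [Finset.sum_insert (by simp [hC])] at hge
    have := hnnM e he
    linarith
  -- reduce to crossing edges
  let X : Finset (Sym2 (Fin (m + 1))) :=
    (ef M).filter (fun e => e ∉ (SimpleGraph.pathGraph (m + 1)).edgeSet ∧ ¬ inC e)
  have hXmem : ∀ e, e ∈ X ↔ e ∈ M.edgeSet ∧
      e ∉ (SimpleGraph.pathGraph (m + 1)).edgeSet ∧ ¬ inC e := by
    intro e; simp only [X, Finset.mem_filter, mem_ef]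
  have hR : blueRevenue (SimpleGraph.pathGraph (m + 1)) p M =
      ∑ e ∈ X, cw (SimpleGraph.pathGraph (m + 1)) c p e := by
    rw [blue_eq _ c]
    symm
    refine Finset.sum_subset ?_ ?_
    · intro e he
      have := (hXmem e).1 he
      exact Finset.mem_filter.2 ⟨(mem_ef _ _).2 this.1, this.2.1⟩
    · intro e he hne
      rw [Finset.mem_filter, mem_ef] at he
      refine hfree e he.1 ?_
      by_contra hC
      exact hne ((hXmem e).2 ⟨he.1, he.2, hC⟩)
  have hRW : ∑ e ∈ X, cw (SimpleGraph.pathGraph (m + 1)) c p e ≤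
      weight (SimpleGraph.pathGraph (m + 1)) c p M :=
    weight_ge _ c p M hnnM X (fun e he => ((hXmem e).1 he).1)
  have hX1 : ∀ f ∈ X, weight (SimpleGraph.pathGraph (m + 1)) c p M ≤
      1 + cw (SimpleGraph.pathGraph (m + 1)) c p f := by
    intro f hf
    obtain ⟨hfM, hfT, hfC⟩ := (hXmem f).1 hf
    have hrep : ∃ a b : Fin (m + 1), f = s(a, b) ∧ (a : ℕ) < 2 ∧ 2 ≤ (b : ℕ) := by
      induction f using Sym2.ind with
      | _ a b =>
        rw [SimpleGraph.mem_edgeSet] at hfM hfT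
        rw [SimpleGraph.pathGraph_adj] at hfT
        have hab : (a : ℕ) ≠ b := fun h => hfM.ne (Fin.ext h)
        by_cases ha : (a : ℕ) < 2
        · exact ⟨a, b, rfl, ha, by omega⟩
        · by_cases hb : (b : ℕ) < 2
          · exact ⟨b, a, Sym2.eq_swap, hb, by omega⟩
          · exfalso; apply hfC
            intro v hv
            rw [Sym2.mem_iff] at hv
            rcases hv with rfl | rfl <;> omega
    obtain ⟨a, b, rfl, ha, hb⟩ := hrep
    obtain ⟨H, hle, hconn, -, -, hw⟩ := comparison c p hc v0 v1 v2 h0 h1 h2 F hp a b ha hb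
      (hMF a b hfM hfT) hfT
    exact (hcomp H hle hconn).trans hw
  rw [hR]
  by_cases htwo : ∃ f ∈ X, ∃ g ∈ X, f ≠ g
  · obtain ⟨f, hf, g, hg, hfg⟩ := htwo
    have hge := weight_ge (SimpleGraph.pathGraph (m + 1)) c p M hnnM {f, g} (by
      intro x hx
      simp only [Finset.mem_insert, Finset.mem_singleton] at hx
      rcases hx with rfl | rfl
      · exact ((hXmem _).1 hf).1
      · exact ((hXmem _).1 hg).1)
    rw [Finset.sum_pair hfg] at hge
    have := hX1 f hf
    have := hX1 g hg
    linarith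
  · push Not at htwo
    rcases X.eq_empty_or_nonempty with hE | ⟨f, hf⟩
    · rw [hE]; simp
    · have hXf : X = {f} := by
        ext e; rw [Finset.mem_singleton]
        exact ⟨fun h => htwo e h f hf, fun h => h ▸ hf⟩
      have hfT := ((hXmem f).1 hf).2.1
      rw [hXf, Finset.sum_singleton]
      have hred : ∀ a b : Fin (m + 1), (a : ℕ) + 1 = b → (a : ℕ) < 2 → M.Adj a b →
          cw (SimpleGraph.pathGraph (m + 1)) c p f ≤ 2 := by
        intro a b hab ha hMab
        have hv : 1 ≤ cw (SimpleGraph.pathGraph (m + 1)) c p s(a, b) := by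
          rw [cw_red c p hc a b hab]
          split_ifs <;> first | omega | norm_num
        have hne : s(a, b) ≠ f := by
          rintro rfl
          apply hfT
          rw [SimpleGraph.mem_edgeSet, SimpleGraph.pathGraph_adj]; exact Or.inl hab
        have hge := weight_ge (SimpleGraph.pathGraph (m + 1)) c p M hnnM {s(a, b), f} (by
          intro x hx
          simp only [Finset.mem_insert, Finset.mem_singleton] at hx
          rcases hx with rfl | rfl
          · exact hMab
          · exact ((hXmem _).1 hf).1)
        rw [Finset.sum_pair hne] at hge
        linarith
      obtain ⟨a, b, ha, hb, hab⟩ := exists_cross M hM.2.connected (fun x => (x : ℕ) = 0) v0 v1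
        h0 (by omega)
      obtain ⟨d, e, hd, he, hde⟩ := exists_cross M hM.2.connected (fun x => (x : ℕ) = 1) v1 v0
        h1 (by omega)
      by_cases hb1 : (b : ℕ) = 1
      · exact hred a b (by omega) (by omega) hab
      by_cases he0 : (e : ℕ) = 0
      · exact hred e d (by omega) (by omega) hde.symm
      by_cases he2 : (e : ℕ) = 2
      · exact hred d e (by omega) (by omega) hde
      exfalso
      have m1 : s(a, b) ∈ X := by
        rw [hXmem]
        refine ⟨hab, ?_, ?_⟩
        · rw [SimpleGraph.mem_edgeSet, SimpleGraph.pathGraph_adj]; omega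
        · intro h; have := h a (by simp); omega
      have m2 : s(d, e) ∈ X := by
        rw [hXmem]
        refine ⟨hde, ?_, ?_⟩
        · rw [SimpleGraph.mem_edgeSet, SimpleGraph.pathGraph_adj]; omega
        · intro h; have := h d (by simp); omega
      have := htwo _ m1 _ m2
      rw [Sym2.eq_iff] at this
      rcases this with ⟨h, h'⟩ | ⟨h, h'⟩ <;>
      · have := congrArg Fin.val h; have := congrArg Fin.val h'; omega

theorem follower_le_two (c p : Sym2 (Fin (m + 1)) → ℝ)
    (hc : ∀ i : Fin m, c (pathEdge m i) =
      if (i : ℕ) = 0 then 1 else if (i : ℕ) = 1 then 2 else 0)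
    (v0 v1 v2 : Fin (m + 1)) (h0 : (v0 : ℕ) = 0) (h1 : (v1 : ℕ) = 1) (h2 : (v2 : ℕ) = 2)
    (F : SimpleGraph (Fin (m + 1))) (hp : ∀ e ∈ F.edgeSet, 0 ≤ p e) :
    followerRevenue (SimpleGraph.pathGraph (m + 1)) c F p ≤ 2 := by
  refine Real.sSup_le ?_ (by norm_num)
  rintro r ⟨M, hM, hmin, rfl⟩
  exact blue_le_two c p hc v0 v1 v2 h0 h1 h2 F hp M hM hmin

/-- The leader can earn `2`. -/
theorem follower_eq_two (c : Sym2 (Fin (m + 1)) → ℝ)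
    (hc : ∀ i : Fin m, c (pathEdge m i) =
      if (i : ℕ) = 0 then 1 else if (i : ℕ) = 1 then 2 else 0)
    (v0 v1 v2 : Fin (m + 1)) (h0 : (v0 : ℕ) = 0) (h1 : (v1 : ℕ) = 1) (h2 : (v2 : ℕ) = 2) :
    followerRevenue (SimpleGraph.pathGraph (m + 1)) c
      (SimpleGraph.fromEdgeSet {s(v0, v2)}) (fun _ => 2) = 2 := by
  classical
  have hp : ∀ e ∈ (SimpleGraph.fromEdgeSet {s(v0, v2)}).edgeSet,
      (0 : ℝ) ≤ (fun _ : Sym2 (Fin (m + 1)) => (2 : ℝ)) e := by intro e _; norm_num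
  have hblue : ¬ (SimpleGraph.pathGraph (m + 1)).Adj v0 v2 := by
    rw [SimpleGraph.pathGraph_adj]; omega
  have hF : (SimpleGraph.fromEdgeSet {s(v0, v2)}).Adj v0 v2 := by
    rw [SimpleGraph.fromEdgeSet_adj]
    refine ⟨rfl, ?_⟩
    intro h; have := congrArg Fin.val h; omega
  have hnn := cw_nonneg c (fun _ => 2) hc _ hp
  have h01 : cw (SimpleGraph.pathGraph (m + 1)) c (fun _ => 2) s(v0, v1) = 1 := by
    rw [cw_red c _ hc v0 v1 (by omega), if_pos h0]
  have h12 : cw (SimpleGraph.pathGraph (m + 1)) c (fun _ => 2) s(v1, v2) = 2 := by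
    rw [cw_red c _ hc v1 v2 (by omega), if_neg (by omega), if_pos h1]
  have h02 : cw (SimpleGraph.pathGraph (m + 1)) c (fun _ => 2) s(v0, v2) = 2 := by
    unfold cw; rw [if_neg]; exact hblue
  have n1 := e01_ne_e12 v0 v1 v2 h0 h1 h2
  have n2 : s(v0, v1) ≠ s(v0, v2) := by
    intro h; rw [Sym2.eq_iff] at h
    rcases h with ⟨h, h'⟩ | ⟨h, h'⟩ <;>
    · have := congrArg Fin.val h; have := congrArg Fin.val h'; omega
  have n3 : s(v1, v2) ≠ s(v0, v2) := by
    intro h; rw [Sym2.eq_iff] at h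
    rcases h with ⟨h, h'⟩ | ⟨h, h'⟩ <;>
    · have := congrArg Fin.val h; have := congrArg Fin.val h'; omega
  -- adjacency in the whole graph
  have hadj : ∀ a b : Fin (m + 1), (SimpleGraph.pathGraph (m + 1) ⊔
      SimpleGraph.fromEdgeSet {s(v0, v2)}).Adj a b →
      (a : ℕ) + 1 = b ∨ (b : ℕ) + 1 = a ∨ ((a : ℕ) = 0 ∧ (b : ℕ) = 2) ∨
        ((a : ℕ) = 2 ∧ (b : ℕ) = 0) := by
    intro a b h
    rcases h with h | h
    · rw [SimpleGraph.pathGraph_adj] at h; omega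
    · rw [SimpleGraph.fromEdgeSet_adj] at h
      have h := h.1
      rw [Set.mem_singleton_iff, Sym2.eq_iff] at h
      rcases h with ⟨h, h'⟩ | ⟨h, h'⟩ <;>
      · have := congrArg Fin.val h; have := congrArg Fin.val h'; omega
  -- cuts
  have cut : ∀ M, IsSpanningTreeOf (SimpleGraph.pathGraph (m + 1) ⊔
      SimpleGraph.fromEdgeSet {s(v0, v2)}) M →
      (M.Adj v0 v1 ∨ M.Adj v0 v2) ∧ (M.Adj v0 v1 ∨ M.Adj v1 v2) ∧
        (M.Adj v1 v2 ∨ M.Adj v0 v2) := by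
    intro M hM
    refine ⟨?_, ?_, ?_⟩
    · obtain ⟨a, b, ha, hb, hab⟩ := exists_cross M hM.2.connected (fun x => (x : ℕ) = 0) v0 v1
        h0 (by omega)
      have := hadj a b (hM.1 hab)
      have ea : a = v0 := Fin.ext (by omega)
      by_cases hb1 : (b : ℕ) = 1
      · have eb : b = v1 := Fin.ext (by omega)
        left; rwa [← ea, ← eb]
      · have eb : b = v2 := Fin.ext (by omega)
        right; rwa [← ea, ← eb]
    · obtain ⟨a, b, ha, hb, hab⟩ := exists_cross M hM.2.connected (fun x => (x : ℕ) = 1) v1 v0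
        h1 (by omega)
      have := hadj a b (hM.1 hab)
      have ea : a = v1 := Fin.ext (by omega)
      by_cases hb1 : (b : ℕ) = 0
      · have eb : b = v0 := Fin.ext (by omega)
        left; rw [← ea, ← eb]; exact hab.symm
      · have eb : b = v2 := Fin.ext (by omega)
        right; rwa [← ea, ← eb]
    · obtain ⟨a, b, ha, hb, hab⟩ := exists_cross M hM.2.connected (fun x => (x : ℕ) < 2) v0 v2
        (by omega) (by omega)
      have := hadj a b (hM.1 hab)
      have eb : b = v2 := Fin.ext (by omega)
      by_cases ha0 : (a : ℕ) = 0
      · have ea : a = v0 := Fin.ext (by omega)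
        right; rwa [← ea, ← eb]
      · have ea : a = v1 := Fin.ext (by omega)
        left; rwa [← ea, ← eb]
  have lower : ∀ M, IsSpanningTreeOf (SimpleGraph.pathGraph (m + 1) ⊔
      SimpleGraph.fromEdgeSet {s(v0, v2)}) M →
      3 ≤ weight (SimpleGraph.pathGraph (m + 1)) c (fun _ => 2) M := by
    intro M hM
    have hpair : ∀ e f : Sym2 (Fin (m + 1)), e ≠ f → e ∈ M.edgeSet → f ∈ M.edgeSet →
        cw (SimpleGraph.pathGraph (m + 1)) c (fun _ => 2) e +
          cw (SimpleGraph.pathGraph (m + 1)) c (fun _ => 2) f ≤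
        weight (SimpleGraph.pathGraph (m + 1)) c (fun _ => 2) M := by
      intro e f hne he hf
      rw [← Finset.sum_pair hne]
      refine weight_ge _ c _ M (fun e he => hnn e (SimpleGraph.edgeSet_mono hM.1 he)) _ ?_
      intro x hx
      simp only [Finset.mem_insert, Finset.mem_singleton] at hx
      rcases hx with rfl | rfl <;> assumption
    obtain ⟨k1, k2, k3⟩ := cut M hM
    by_cases a01 : M.Adj v0 v1
    · rcases k3 with k | k
      · have := hpair _ _ n1 a01 k; linarith
      · have := hpair _ _ n2 a01 k; linarith
    · have := hpair _ _ n3 (k2.resolve_left a01) (k1.resolve_left a01); linarith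
  apply le_antisymm (follower_le_two c _ hc v0 v1 v2 h0 h1 h2 _ hp)
  refine le_csSup ?_ ?_
  · refine ⟨2, ?_⟩
    rintro r ⟨M, hM, hmin, rfl⟩
    exact blue_le_two c _ hc v0 v1 v2 h0 h1 h2 _ hp M hM hmin
  · obtain ⟨H, hle, hconn, hbl, hn12, hw⟩ := comparison c (fun _ => 2) hc v0 v1 v2 h0 h1 h2 _ hp
      v0 v2 (by omega) (by omega) hF hblue
    obtain ⟨M, hMH, hMt⟩ := hconn.exists_isTree_le
    have hMs : IsSpanningTreeOf (SimpleGraph.pathGraph (m + 1) ⊔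
      SimpleGraph.fromEdgeSet {s(v0, v2)}) M := ⟨hMH.trans hle, hMt⟩
    refine ⟨M, hMs, ?_, ?_⟩
    · intro M' hM'
      refine le_trans ?_ (lower M' hM')
      have : weight (SimpleGraph.pathGraph (m + 1)) c (fun _ => 2) M ≤
          weight (SimpleGraph.pathGraph (m + 1)) c (fun _ => 2) H := by
        rw [weight_eq _ c _ M]
        refine weight_ge _ c _ H (fun e he => hnn e (SimpleGraph.edgeSet_mono hle he)) _ ?_
        intro e he
        exact SimpleGraph.edgeSet_mono hMH ((mem_ef _ _).1 he)
      linarith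
    · have hM02 : M.Adj v0 v2 := (cut M hMs).2.2.resolve_left (fun h => hn12 (hMH h))
      rw [blue_eq _ c]
      have : (ef M).filter (fun e => e ∉ (SimpleGraph.pathGraph (m + 1)).edgeSet) =
          {s(v0, v2)} := by
        ext e
        rw [Finset.mem_filter, mem_ef, Finset.mem_singleton]
        constructor
        · rintro ⟨h, h'⟩
          exact hbl e (SimpleGraph.edgeSet_mono hMH h) h'
        · rintro rfl
          exact ⟨hM02, hblue⟩
      rw [this, Finset.sum_singleton, h02]

end path

end StackMST

open StackMST

/-- Consider the StackMST(0,0) game whose red tree is a path on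
`n = m + 1 ≥ 4` vertices whose consecutive edges have costs `1, 2, 0, 0, …, 0`.
Then the optimal revenue is exactly `2`, while the total red cost is `3`. -/
theorem stackMST_tight_example (m : ℕ) (hm : 3 ≤ m)
    (c : Sym2 (Fin (m + 1)) → ℝ)
    (hc : ∀ i : Fin m, c (pathEdge m i) =
      if (i : ℕ) = 0 then 1 else if (i : ℕ) = 1 then 2 else 0) :
    optRevenue (SimpleGraph.pathGraph (m + 1)) c = 2 ∧
      redCost (SimpleGraph.pathGraph (m + 1)) c = 3 := by
  obtain ⟨v0, h0⟩ : ∃ v : Fin (m + 1), (v : ℕ) = 0 := ⟨⟨0, by omega⟩, rfl⟩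
  obtain ⟨v1, h1⟩ : ∃ v : Fin (m + 1), (v : ℕ) = 1 := ⟨⟨1, by omega⟩, rfl⟩
  obtain ⟨v2, h2⟩ : ∃ v : Fin (m + 1), (v : ℕ) = 2 := ⟨⟨2, by omega⟩, rfl⟩
  constructor
  · have hub : ∀ r ∈ {r | ∃ (F : SimpleGraph (Fin (m + 1))) (p : Sym2 (Fin (m + 1)) → ℝ),
        IsBlueSet (SimpleGraph.pathGraph (m + 1)) F ∧ (∀ e ∈ F.edgeSet, 0 ≤ p e) ∧
        r = followerRevenue (SimpleGraph.pathGraph (m + 1)) c F p}, r ≤ 2 := by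
      rintro r ⟨F, p, -, hp, rfl⟩
      exact follower_le_two c p hc v0 v1 v2 h0 h1 h2 F hp
    apply le_antisymm
    · exact Real.sSup_le hub (by norm_num)
    · refine le_csSup ⟨2, hub⟩ ?_
      refine ⟨SimpleGraph.fromEdgeSet {s(v0, v2)}, fun _ => 2, ?_, ?_, ?_⟩
      · intro a b hab
        rw [SimpleGraph.fromEdgeSet_adj] at hab
        rw [SimpleGraph.compl_adj]
        refine ⟨hab.2, ?_⟩
        have h := hab.1
        rw [Set.mem_singleton_iff, Sym2.eq_iff] at h
        rw [SimpleGraph.pathGraph_adj]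
        rcases h with ⟨h, h'⟩ | ⟨h, h'⟩ <;>
        · have := congrArg Fin.val h; have := congrArg Fin.val h'; omega
      · intro e _; norm_num
      · exact (follower_eq_two c hc v0 v1 v2 h0 h1 h2).symm
  · have := path_weight_le c (fun _ => 0) hc v0 v1 v2 h0 h1 h2
    unfold weight at this
    rw [Set.inter_self, Set.sdiff_self] at this
    unfold redCost
    rw [← this]
    simp [esum]
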